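/- Let p be an odd prime. Then t_{(p+1)/2} ≡ p·B_{p-1} - 3p + 2^{p-1} - 1 (mod p²), where (t_n) is the sequence defined below and B_{p-1} is the (p-1)-th Bernoulli number. -/

import Mathlib

/-- The sequence `t_0 = 1`, `t_1 = 5`,
`t_{n+1} = (8n²+12n+5) t_n - 4n²(2n+1)² t_{n-1}` for `n ≥ 1`. -/
def t : ℕ → ℤ
  | 0 => 1
  | 1 => 5
  | (n + 2) => (8 * ((n : ℤ) + 1) ^ 2 + 12 * ((n : ℤ) + 1) + 5) * t (n + 1)
      - 4 * ((n : ℤ) + 1) ^ 2 * (2 * ((n : ℤ) + 1) + 1) ^ 2 * t n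

/-- `a ≡ b (mod p^r)` for rationals: `a - b` is `p^r` times a rational whose
denominator (in lowest terms) is not divisible by `p`. -/
def pcong (p r : ℕ) (a b : ℚ) : Prop :=
  ∃ q : ℚ, a - b = (p : ℚ) ^ r * q ∧ ¬ (p ∣ q.den)

/-- The terms of the shifted Legendre polynomial `P_m` at `1`. -/
def legendreTerm (m k : ℕ) : ℤ := (-1) ^ k * m.choose k * (m + k).choose m

theorem legendreTerm_succ (m k : ℕ) :
    ((k : ℤ) + 1) ^ 2 * legendreTerm m (k + 1)
      = -(((m : ℤ) - k) * (m + k + 1)) * legendreTerm m k := by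
  have h1 : (m.choose (k + 1) : ℤ) * (k + 1) = m.choose k * (m - k) := by
    rcases le_or_gt k m with h | h
    · have := Nat.choose_succ_right_eq m k
      zify [h] at this
      exact this
    · simp [Nat.choose_eq_zero_of_lt h, Nat.choose_eq_zero_of_lt (h.trans (Nat.lt_succ_self k))]
  have h2 : ((m + (k + 1)).choose m : ℤ) * (k + 1) = (m + k).choose m * (m + k + 1) := by
    have := Nat.choose_mul_succ_eq (m + k) m
    rw [show m + k + 1 - m = k + 1 by omega] at this
    zify at this
    exact this.symm
  unfold legendreTerm
  linear_combination
    (-(-1) ^ k * ((m + (k + 1)).choose m : ℤ) * (k + 1)) * h1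
      - ((-1) ^ k * (m.choose k : ℤ) * (m - k)) * h2

theorem sum_legendreTerm (m : ℕ) :
    ∑ k ∈ Finset.range (m + 1), legendreTerm m k = (-1) ^ m := by
  have h := Polynomial.shiftedLegendre_eval_symm m (1 : ℤ)
  simpa [Polynomial.shiftedLegendre, Polynomial.aeval_def, Polynomial.eval₂_finsetSum,
    Finset.sum_range_succ' _ m, legendreTerm] using h

/-- The product of the first `n` odd numbers. -/
def oddProd (n : ℕ) : ℤ := ∏ i ∈ Finset.range n, (2 * (i : ℤ) + 1)

theorem oddProd_succ (n : ℕ) : oddProd (n + 1) = oddProd n * (2 * n + 1) :=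
  Finset.prod_range_succ _ _

theorem factorial_two_mul_eq (n : ℕ) :
    ((2 * n).factorial : ℤ) = 2 ^ n * n.factorial * oddProd n := by
  induction n with
  | zero => simp [oddProd]
  | succ n ih =>
    rw [show 2 * (n + 1) = 2 * n + 1 + 1 by ring, Nat.factorial_succ, Nat.factorial_succ,
      Nat.factorial_succ, oddProd_succ]
    push_cast
    rw [ih]
    ring

theorem t_succ (n : ℕ) : t (n + 1) = (2 * n + 2) ^ 2 * t n + oddProd (n + 1) ^ 2 := by
  induction n with
  | zero => simp [t, oddProd]
  | succ n ih =>
    rw [oddProd_succ, t]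
    push_cast
    linear_combination (2 * (n : ℤ) + 3) ^ 2 * ih

theorem oddProd_sq_modEq (m k : ℕ) :
    oddProd k ^ 2 ≡ 4 ^ k * k.factorial ^ 2 * legendreTerm m k [ZMOD (2 * m + 1) ^ 2] := by
  induction k with
  | zero => simp [oddProd, legendreTerm, Int.ModEq.refl]
  | succ k ih =>
    have h := legendreTerm_succ m k
    rw [Int.modEq_iff_dvd] at ih ⊢
    obtain ⟨c, hc⟩ := ih
    refine ⟨(2 * k + 1) ^ 2 * c - 4 ^ k * k.factorial ^ 2 * legendreTerm m k, ?_⟩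
    rw [oddProd_succ, Nat.factorial_succ]
    push_cast
    linear_combination 4 ^ (k + 1) * (k.factorial : ℤ) ^ 2 * h + (2 * (k : ℤ) + 1) ^ 2 * hc

theorem t_modEq_sum (m n : ℕ) :
    t n ≡ 4 ^ n * n.factorial ^ 2 * ∑ k ∈ Finset.range (n + 1), legendreTerm m k
      [ZMOD (2 * m + 1) ^ 2] := by
  induction n with
  | zero => simp [t, legendreTerm, Int.ModEq.refl]
  | succ n ih =>
    have h := (ih.mul_left ((2 * n + 2) ^ 2)).add (oddProd_sq_modEq m (n + 1))
    rw [t_succ]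
    convert h using 1
    rw [Finset.sum_range_succ _ (n + 1), Nat.factorial_succ]
    push_cast
    ring

theorem t_succ_modEq (m : ℕ) :
    t (m + 1) ≡ (2 * m + 2) ^ 2 * (4 ^ m * m.factorial ^ 2 * (-1) ^ m)
      [ZMOD (2 * m + 1) ^ 2] := by
  have h := t_modEq_sum m m
  rw [sum_legendreTerm] at h
  have h2 : oddProd (m + 1) ^ 2 ≡ 0 [ZMOD (2 * m + 1) ^ 2] := by
    rw [Int.modEq_zero_iff_dvd, oddProd_succ, mul_pow]
    exact dvd_mul_left _ _
  rw [t_succ]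
  simpa using (h.mul_left ((2 * m + 2) ^ 2)).add h2

theorem sq_dvd_eval_second_difference (f : Polynomial ℤ) (x : ℤ) :
    x ^ 2 ∣ f.eval (2 * x) - 2 * f.eval x + f.eval 0 := by
  obtain ⟨a, ha⟩ := f.binomExpansion 0 x
  obtain ⟨b, hb⟩ := f.binomExpansion 0 (2 * x)
  rw [zero_add] at ha hb
  exact ⟨4 * b - 2 * a, by linear_combination hb - 2 * ha⟩

theorem four_pow_mul_factorial_modEq (m : ℕ) :
    4 ^ m * m.factorial ^ 2 * (-1) ^ m
      ≡ 2 * (2 * m).factorial - 4 ^ m * (2 * m).factorial [ZMOD (2 * m + 1) ^ 2] := by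
  set f : Polynomial ℤ := ∏ i ∈ Finset.range m, (Polynomial.X - Polynomial.C (2 * ((i : ℤ) + 1)))
    with hf
  have h0 : f.eval 0 = (-1) ^ m * 2 ^ m * m.factorial := by
    simp only [hf, Polynomial.eval_prod, Polynomial.eval_sub, Polynomial.eval_X,
      Polynomial.eval_C, zero_sub]
    rw [← Finset.prod_range_add_one_eq_factorial, Finset.prod_neg, Finset.prod_mul_distrib]
    push_cast
    simp
    ring
  have h1 : f.eval (2 * m + 1 : ℤ) = oddProd m := by
    simp only [hf, Polynomial.eval_prod, Polynomial.eval_sub, Polynomial.eval_X,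
      Polynomial.eval_C]
    rw [oddProd, ← Finset.prod_range_reflect]
    refine Finset.prod_congr rfl fun i hi => ?_
    have : i + 1 ≤ m := Finset.mem_range.1 hi
    rw [show m - 1 - i = m - (i + 1) by omega]
    push_cast [this]
    ring
  have h2 : f.eval (2 * (2 * m + 1) : ℤ) * m.factorial = 2 ^ m * (2 * m).factorial := by
    have h := Nat.factorial_mul_descFactorial (show m ≤ 2 * m by omega)
    rw [show 2 * m - m = m by omega, Nat.descFactorial_eq_prod_range] at h
    rw [← h]
    simp only [hf, Polynomial.eval_prod, Polynomial.eval_sub, Polynomial.eval_X,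
      Polynomial.eval_C]
    have : ∏ i ∈ Finset.range m, (2 * (2 * (m : ℤ) + 1) - 2 * ((i : ℤ) + 1))
        = 2 ^ m * ∏ i ∈ Finset.range m, ((2 * m - i : ℕ) : ℤ) := by
      rw [← Finset.card_range m, ← Finset.prod_const, Finset.card_range,
        ← Finset.prod_mul_distrib]
      refine Finset.prod_congr rfl fun i hi => ?_
      have : i ≤ 2 * m := by have := Finset.mem_range.1 hi; omega
      push_cast [this]
      ring
    rw [this]
    push_cast
    ring
  obtain ⟨c, hc⟩ := sq_dvd_eval_second_difference f (2 * m + 1)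
  rw [h0, h1] at hc
  have h4 : (4 : ℤ) ^ m = 2 ^ m * 2 ^ m := by rw [← mul_pow]; norm_num
  rw [Int.modEq_iff_dvd]
  refine ⟨-(2 ^ m * m.factorial * c), ?_⟩
  rw [h4]
  linear_combination (-2 ^ m * (m.factorial : ℤ)) * hc + 2 ^ m * h2 + 2 * factorial_two_mul_eq m

theorem prod_modEq_one_add_sum {ι : Type*} (s : Finset ι) (f : ι → ℤ) (n : ℤ)
    (h : ∀ i ∈ s, f i ≡ 1 [ZMOD n]) :
    ∏ i ∈ s, f i ≡ 1 + ∑ i ∈ s, (f i - 1) [ZMOD n ^ 2] := by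
  classical
  induction s using Finset.induction_on with
  | empty => simp [Int.ModEq.refl]
  | insert a s ha ih =>
    rw [Finset.prod_insert ha, Finset.sum_insert ha]
    refine ((ih fun i hi => h i (Finset.mem_insert_of_mem hi)).mul_left (f a)).trans ?_
    have h1 : n ∣ f a - 1 := (h a (Finset.mem_insert_self a s)).symm.dvd
    have h2 : n ∣ ∑ i ∈ s, (f i - 1) :=
      Finset.dvd_sum fun i hi => (h i (Finset.mem_insert_of_mem hi)).symm.dvd
    rw [Int.modEq_iff_dvd]
    obtain ⟨c, hc⟩ := h1
    obtain ⟨d, hd⟩ := h2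
    refine ⟨-(c * d), ?_⟩
    linear_combination (-∑ i ∈ s, (f i - 1)) * hc - n * c * hd

theorem factorial_pred_modEq_neg_one {p : ℕ} (hp : p.Prime) :
    ((p - 1).factorial : ℤ) ≡ -1 [ZMOD p] := by
  have := Fact.mk hp
  rw [← ZMod.intCast_eq_intCast_iff]
  simp

theorem pow_pred_modEq_one {p a : ℕ} (hp : p.Prime) (ha : a ∈ Finset.Ico 1 p) :
    (a : ℤ) ^ (p - 1) ≡ 1 [ZMOD p] := by
  rw [Finset.mem_Ico] at ha
  exact Int.ModEq.pow_card_sub_one_eq_one hp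
    (Nat.isCoprime_iff_coprime.2 (Nat.coprime_of_lt_prime (by omega) ha.2 hp).symm)

/-- The sum of `(p - 1)`-th powers of `1, …, p - 1` in terms of the Wilson quotient. -/
theorem sum_pow_pred_modEq {p : ℕ} (hp : p.Prime) (hodd : Odd p) :
    ∑ a ∈ Finset.Ico 1 p, (a : ℤ) ^ (p - 1) ≡ (p - 1).factorial + p [ZMOD (p : ℤ) ^ 2] := by
  obtain ⟨m, rfl⟩ := hodd
  have h1 := prod_modEq_one_add_sum (Finset.Ico 1 (2 * m + 1))
    (fun a => (a : ℤ) ^ (2 * m + 1 - 1)) _ fun a ha => pow_pred_modEq_one hp ha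
  rw [Finset.prod_pow, ← Nat.cast_prod, Finset.prod_Ico_id_eq_factorial, Finset.sum_sub_distrib]
    at h1
  obtain ⟨w, hw⟩ := (factorial_pred_modEq_neg_one hp).symm.dvd
  simp only [Nat.add_sub_cancel] at *
  have h2 := prod_modEq_one_add_sum (Finset.range m) (fun _ => ((2 * m).factorial : ℤ) ^ 2)
    ((2 * m + 1 : ℕ) : ℤ) fun _ _ => by
      simpa using (factorial_pred_modEq_neg_one hp).pow 2
  simp only [Finset.prod_const, Finset.card_range, Finset.sum_const, ← pow_mul, nsmul_eq_mul] at h2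
  obtain ⟨c, hc⟩ := h1.symm.trans h2 |>.dvd
  simp only [Finset.sum_const, Nat.card_Ico, Nat.add_sub_cancel, nsmul_eq_mul, mul_one] at hc
  rw [Int.modEq_iff_dvd]
  have hW : ((2 * m).factorial : ℤ) = (2 * m + 1 : ℕ) * w - 1 := by linear_combination hw
  rw [hW] at hc ⊢
  refine ⟨c + 2 * w - m * w ^ 2 - w, ?_⟩
  push_cast at hc ⊢
  linear_combination hc

section Integrality

variable {p : ℕ} [Fact p.Prime]

theorem mem_integer_iff {q : ℚ} : q ∈ (Rat.padicValuation p).integer ↔ ¬ p ∣ q.den :=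
  Rat.padicValuation_le_one_iff

theorem inv_natCast_mem_integer {n : ℕ} (h0 : 0 < n) (h : n < p) :
    (n : ℚ)⁻¹ ∈ (Rat.padicValuation p).integer := by
  rw [mem_integer_iff, Rat.inv_natCast_den_of_pos h0]
  exact Nat.not_dvd_of_pos_of_lt h0 h

theorem bernoulli_mem_integer {i : ℕ} (hi : i + 1 < p) :
    bernoulli i ∈ (Rat.padicValuation p).integer := by
  induction i using Nat.strong_induction_on with
  | _ i ih =>
    have h := sum_bernoulli (i + 1)
    rw [Finset.sum_range_succ, Nat.choose_succ_self_right] at h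
    have h2 : bernoulli i = ((i + 1 : ℕ) : ℚ)⁻¹ * ((if i + 1 = 1 then 1 else 0)
        - ∑ k ∈ Finset.range i, ((i + 1).choose k : ℚ) * bernoulli k) := by
      rw [← h]
      field_simp
      ring
    rw [h2]
    refine mul_mem (inv_natCast_mem_integer i.succ_pos hi) (sub_mem ?_ (sum_mem fun k hk => ?_))
    · split_ifs
      exacts [one_mem _, zero_mem _]
    · have := Finset.mem_range.1 hk
      exact mul_mem (natCast_mem _ _) (ih k this (by omega))

theorem exists_sum_pow_sub_bernoulli (hodd : Odd p) :
    ∃ q ∈ (Rat.padicValuation p).integer,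
      ∑ a ∈ Finset.range p, (a : ℚ) ^ (p - 1) - p * bernoulli (p - 1) = p ^ 2 * q := by
  have hp : p.Prime := Fact.out
  have hp0 : (p : ℚ) ≠ 0 := by exact_mod_cast hp.ne_zero
  have hp3 : 3 ≤ p := by
    have := hp.two_le
    obtain ⟨m, hm⟩ := hodd
    omega
  have hterm : ∀ i ∈ Finset.range (p - 1), ∃ q ∈ (Rat.padicValuation p).integer,
      bernoulli i * (p.choose i) * (p : ℚ) ^ (p - i) / p = p ^ 2 * q := by
    intro i hi
    have hi' := Finset.mem_range.1 hi
    have hB : bernoulli i ∈ (Rat.padicValuation p).integer := bernoulli_mem_integer (by omega)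
    rcases Nat.eq_zero_or_pos i with rfl | h0
    · refine ⟨(p : ℚ) ^ (p - 3), pow_mem (natCast_mem _ _) _, ?_⟩
      rw [div_eq_iff hp0, Nat.sub_zero, bernoulli_zero, Nat.choose_zero_right]
      nth_rewrite 2 [show p = 2 + (p - 3) + 1 by omega]
      rw [pow_succ, pow_add]
      push_cast
      ring
    · obtain ⟨c, hc⟩ := hp.dvd_choose_self h0.ne' (by omega)
      refine ⟨bernoulli i * c * (p : ℚ) ^ (p - i - 2),
        mul_mem (mul_mem hB (natCast_mem _ _)) (pow_mem (natCast_mem _ _) _), ?_⟩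
      rw [div_eq_iff hp0, hc, show p - i = 2 + (p - i - 2) by omega, pow_add,
        show 2 + (p - i - 2) - 2 = p - i - 2 by omega]
      push_cast
      ring
  choose! g hg hgeq using hterm
  refine ⟨∑ i ∈ Finset.range (p - 1), g i, sum_mem hg, ?_⟩
  have hc : ((p - 1 : ℕ) : ℚ) + 1 = p := by
    rw [← Nat.cast_add_one, Nat.sub_add_cancel hp.one_le]
  rw [sum_range_pow, Finset.sum_range_succ, hc, Nat.sub_add_cancel hp.one_le,
    Finset.sum_congr rfl hgeq, ← Finset.mul_sum, show p - (p - 1) = 1 by omega,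
    Nat.choose_symm hp.one_le, Nat.choose_one_right]
  field_simp
  ring

end Integrality

theorem t_half_succ_modEq {p : ℕ} (hp : p.Prime) (hodd : Odd p) :
    t ((p + 1) / 2) ≡ ∑ a ∈ Finset.Ico 1 p, (a : ℤ) ^ (p - 1) - 3 * p + 2 ^ (p - 1) - 1
      [ZMOD (p : ℤ) ^ 2] := by
  have hS := sum_pow_pred_modEq hp hodd
  obtain ⟨w, hw⟩ := (factorial_pred_modEq_neg_one hp).symm.dvd
  have hp2 : 2 ∈ Finset.Ico 1 p := by
    obtain ⟨m, hm⟩ := hodd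
    have := hp.two_le
    rw [Finset.mem_Ico]
    omega
  obtain ⟨q, hq⟩ := (pow_pred_modEq_one hp hp2).symm.dvd
  obtain ⟨m, rfl⟩ := hodd
  have ht := (t_succ_modEq m).trans ((four_pow_mul_factorial_modEq m).mul_left _)
  rw [show (2 * m + 1 + 1) / 2 = m + 1 by omega]
  simp only [Nat.add_sub_cancel] at *
  push_cast at *
  refine ht.trans (Int.ModEq.trans ?_ (((hS.symm.sub_right _).add_right _).sub_right _))
  rw [pow_mul] at hq ⊢
  norm_num at hq ⊢
  have hW : ((2 * m).factorial : ℤ) = (2 * m + 1) * w - 1 := by linear_combination hw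
  have hQ : (4 : ℤ) ^ m = (2 * m + 1) * q + 1 := by linear_combination hq
  rw [hW, hQ, Int.modEq_iff_dvd]
  generalize (m : ℤ) = x
  refine ⟨w * q - 2 * (w + q) + 2 * (2 * x + 1) * w * q
    - (-1 + (2 * x + 1) * (w + q) - (2 * x + 1) ^ 2 * w * q), ?_⟩
  ring

theorem t_half_succ_cong (p : ℕ) (hp : p.Prime) (hodd : Odd p) :
    pcong p 2 ((t ((p + 1) / 2) : ℚ))
      ((p : ℚ) * bernoulli (p - 1) - 3 * p + 2 ^ (p - 1) - 1) := by
  have := Fact.mk hp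
  obtain ⟨q, hq, hS⟩ := exists_sum_pow_sub_bernoulli hodd
  obtain ⟨c, hc⟩ := (t_half_succ_modEq hp hodd).symm.dvd
  refine ⟨c + q, ?_, mem_integer_iff.1 (add_mem (intCast_mem _ _) hq)⟩
  have hp1 : p - 1 ≠ 0 := by have := hp.two_le; omega
  rw [Finset.range_eq_Ico, Finset.sum_eq_sum_Ico_succ_bot hp.pos, Nat.cast_zero,
    zero_pow hp1, zero_add, zero_add] at hS
  have hc' := congrArg (Int.cast : ℤ → ℚ) hc
  push_cast at hc'
  linear_combination hc' + hS
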